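/- arXiv:1511.01211 — 4 statements merged into one kernel-verified Lean document; each statement's English description precedes it below -/
import Mathlib

section
/- Let 𝒳 be a nonempty finite set and f : 𝒳 → ℝ with 0 ≤ f x ≤ 1 for all x. Set p := (∑_{x∈𝒳} f x)/|𝒳| and assume p > 0, and set q x := f x / (∑_{x∈𝒳} f x). Then p · (log₂|𝒳| − H₂(q)) ≤ h₂(p). (This is the inequality E[E]·(ν − H(X | E=1)) ≤ H(E) for X uniform on 𝒳 and a Boolean random variable E with P(E=1|X=x) = f x.) -/
/-- Shannon entropy (in bits) of a probability vector `q` on a finite set,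
with the convention that terms with `q x = 0` contribute `0`. -/
noncomputable def shannonEntropy {𝒳 : Type*} [Fintype 𝒳] (q : 𝒳 → ℝ) : ℝ :=
  ∑ x, q x * Real.logb 2 (1 / q x)

/-- Binary entropy function (in bits), with the convention `0 · logb 2 0 = 0`. -/
noncomputable def binEntropy2 (p : ℝ) : ℝ :=
  -p * Real.logb 2 p - (1 - p) * Real.logb 2 (1 - p)

/-- For `X` uniform on a nonempty finite set `𝒳` and a Boolean random variable `E` with
`P(E = 1 | X = x) = f x` and `p := P(E = 1)`, one has
`P(E=1) · (log₂|𝒳| − H₂(X | E=1)) ≤ H₂(E)`. -/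
theorem entropy_ineq {𝒳 : Type*} [Fintype 𝒳] [Nonempty 𝒳]
    (f : 𝒳 → ℝ) (hf0 : ∀ x, 0 ≤ f x) (hf1 : ∀ x, f x ≤ 1)
    (p : ℝ) (hp : p = (∑ x, f x) / (Fintype.card 𝒳 : ℝ)) (hppos : 0 < p)
    (q : 𝒳 → ℝ) (hq : ∀ x, q x = f x / (∑ y, f y)) :
    p * (Real.logb 2 (Fintype.card 𝒳 : ℝ) - shannonEntropy q) ≤ binEntropy2 p := by
  have hn : (0:ℝ) < (Fintype.card 𝒳 : ℝ) := by exact_mod_cast Fintype.card_pos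
  have hS : ∑ x, f x = p * (Fintype.card 𝒳 : ℝ) := by rw [hp]; field_simp
  have hSpos : 0 < ∑ x, f x := by rw [hS]; positivity
  have hp1 : p ≤ 1 := by
    rw [hp, div_le_one hn]
    calc ∑ x, f x ≤ ∑ _x : 𝒳, (1:ℝ) := Finset.sum_le_sum (fun x _ => hf1 x)
      _ = _ := by simp
  have hq1 : ∑ x, q x = 1 := by
    simp_rw [hq]
    rw [← Finset.sum_div, div_self hSpos.ne']
  have hH : Real.logb 2 (∑ x, f x) ≤ shannonEntropy q := by
    unfold shannonEntropy
    calc Real.logb 2 (∑ x, f x) = ∑ x, q x * Real.logb 2 (∑ x, f x) := by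
          rw [← Finset.sum_mul, hq1, one_mul]
      _ ≤ _ := by
          refine Finset.sum_le_sum (fun x _ => ?_)
          rcases (hf0 x).eq_or_lt with h | h
          · simp [hq, ← h]
          · have hqx : 0 ≤ q x := by rw [hq]; positivity
            refine mul_le_mul_of_nonneg_left ?_ hqx
            refine Real.logb_le_logb_of_le (by norm_num) hSpos ?_
            rw [hq, one_div_div, le_div_iff₀ h]
            exact mul_le_of_le_one_right hSpos.le (hf1 x)
  have hlog : Real.logb 2 (∑ x, f x) = Real.logb 2 p + Real.logb 2 (Fintype.card 𝒳 : ℝ) := by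
    rw [hS, Real.logb_mul hppos.ne' hn.ne']
  have h2 : Real.logb 2 (1 - p) ≤ 0 :=
    Real.logb_nonpos (by norm_num) (by linarith) (by linarith)
  have h3 : (1 - p) * Real.logb 2 (1 - p) ≤ 0 :=
    mul_nonpos_of_nonneg_of_nonpos (by linarith) h2
  have h4 : p * (Real.logb 2 (Fintype.card 𝒳 : ℝ) - shannonEntropy q) ≤ p * (-Real.logb 2 p) :=
    mul_le_mul_of_nonneg_left (by linarith) hppos.le
  unfold binEntropy2
  linarith
end

section
/- Let 𝒳 and ℬ be nonempty finite sets and let w : 𝒳 → ℬ → ℝ be nonnegative with ∑_{β∈ℬ} w x β = 1/|𝒳| for every x ∈ 𝒳 (the joint distribution of a pair (X, B) where X is uniform on 𝒳). For β ∈ ℬ set P(β) := ∑_{x∈𝒳} w x β, and when P(β) > 0 let q_β x := w x β / P(β) be the conditional distribution of X given B = β. Then for every real h, ∑ over those β ∈ ℬ with P(β) > 0 and H₂(q_β) ≤ h of P(β) is at most |ℬ| · 2^{h+3} / |𝒳|. (In particular, conditioning a uniform random variable on the value of a message taking at most |ℬ| values leaves entropy greater than h except with probability |ℬ|·2^{h+3}/|𝒳|.)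 -/
open scoped Classical

/-- Let `(X, B)` be a pair of random variables with `X` uniform on `𝒳` and joint distribution
`w` (so `∑_β w x β = 1/|𝒳|` for each `x`).  The total probability of those messages `β`
for which the conditional distribution of `X` given `B = β` has entropy at most `h`
is at most `|ℬ| · 2^(h+3) / |𝒳|`. -/
theorem low_entropy_messages_rare {𝒳 ℬ : Type*} [Fintype 𝒳] [Fintype ℬ]
    [Nonempty 𝒳] [Nonempty ℬ]
    (w : 𝒳 → ℬ → ℝ) (hw : ∀ x β, 0 ≤ w x β)
    (hmarg : ∀ x, ∑ β, w x β = 1 / (Fintype.card 𝒳 : ℝ)) (h : ℝ) :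
    ∑ β ∈ Finset.univ.filter
        (fun β : ℬ => 0 < ∑ x, w x β ∧
          shannonEntropy (fun x => w x β / ∑ y, w y β) ≤ h),
      (∑ x, w x β)
      ≤ (Fintype.card ℬ : ℝ) * (2 : ℝ) ^ (h + 3) / (Fintype.card 𝒳 : ℝ) := by
  have hN : (0 : ℝ) < (Fintype.card 𝒳 : ℝ) := by exact_mod_cast Fintype.card_pos
  have hle : ∀ x β, w x β ≤ 1 / (Fintype.card 𝒳 : ℝ) := by
    intro x β
    rw [← hmarg x]
    exact Finset.single_le_sum (fun b _ => hw x b) (Finset.mem_univ β)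
  have key : ∀ β ∈ Finset.univ.filter
        (fun β : ℬ => 0 < ∑ x, w x β ∧
          shannonEntropy (fun x => w x β / ∑ y, w y β) ≤ h),
      (∑ x, w x β) ≤ (2 : ℝ) ^ (h + 3) / (Fintype.card 𝒳 : ℝ) := by
    intro β hβ
    obtain ⟨hP, hH⟩ := (Finset.mem_filter.mp hβ).2
    set P := ∑ y, w y β with hPdef
    have hNP : 0 < (Fintype.card 𝒳 : ℝ) * P := mul_pos hN hP
    have h1 : Real.logb 2 ((Fintype.card 𝒳 : ℝ) * P) ≤ h := by
      refine le_trans ?_ hH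
      have hs : ∑ x, w x β / P = 1 := by
        rw [← Finset.sum_div, ← hPdef, div_self hP.ne']
      calc Real.logb 2 ((Fintype.card 𝒳 : ℝ) * P)
          = ∑ x, w x β / P * Real.logb 2 ((Fintype.card 𝒳 : ℝ) * P) := by
            rw [← Finset.sum_mul, hs, one_mul]
        _ ≤ _ := by
            unfold shannonEntropy
            refine Finset.sum_le_sum fun x _ => ?_
            rcases (hw x β).eq_or_lt with h0 | h0
            · simp [← h0]
            · refine mul_le_mul_of_nonneg_left ?_ (div_pos h0 hP).le
              refine Real.logb_le_logb_of_le (by norm_num) hNP ?_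
              rw [one_div_div, le_div_iff₀ h0]
              have := (le_div_iff₀ hN).mp (hle x β)
              nlinarith
    have h2 := (Real.logb_le_iff_le_rpow (by norm_num) hNP).mp h1
    have h3 : (2 : ℝ) ^ h ≤ (2 : ℝ) ^ (h + 3) :=
      Real.rpow_le_rpow_of_exponent_le (by norm_num) (by linarith)
    rw [le_div_iff₀ hN]
    linarith
  refine (Finset.sum_le_card_nsmul _ _ _ key).trans ?_
  rw [nsmul_eq_mul, mul_div_assoc]
  refine mul_le_mul_of_nonneg_right ?_ (by positivity)
  exact_mod_cast Finset.card_le_univ _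
end

section
/- Let 1 ≤ a ≤ n, let μ be the uniform probability measure on the unit sphere of EuclideanSpace ℝ (Fin n), and for x on the sphere let L(x) := ∑_{i < a} (x i)² be the squared length of the projection of x onto the span of the first a standard basis vectors. Then for every real β with 0 ≤ β < 1/2: (a) μ{x : L(x) ≤ (1−β)·a/n} ≤ exp(−a·β²/4), and (b) μ{x : L(x) ≥ (1+β)·a/n} ≤ exp(−a·β²/8). -/
open MeasureTheory ProbabilityTheory

theorem jl_charFun_norm {E : Type*} [NormedAddCommGroup E] [InnerProductSpace ℝ E]
    [FiniteDimensional ℝ E] [MeasurableSpace E] [BorelSpace E] (μ : Measure E)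
    (hinv : ∀ U : E ≃ₗᵢ[ℝ] E, μ.map U = μ) (s t : E) (h : ‖s‖ = ‖t‖) :
    charFun μ s = charFun μ t := by
  set U := ((ℝ ∙ (s - t))ᗮ).reflection with hU
  have hUs : U s = t := Submodule.reflection_sub h
  rw [charFun_apply t, ← hinv U, integral_map (by fun_prop)
    (Measurable.aestronglyMeasurable (by fun_prop)), hinv U, charFun_apply]
  simp_rw [← hUs, LinearIsometryEquiv.inner_map_map]

theorem jl_uniq {E : Type*} [NormedAddCommGroup E] [InnerProductSpace ℝ E]
    [FiniteDimensional ℝ E] [MeasurableSpace E] [BorelSpace E] (μ ν : Measure E)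
    [IsProbabilityMeasure μ] [IsProbabilityMeasure ν]
    (hμs : ∀ᵐ x ∂μ, ‖x‖ = 1) (hνs : ∀ᵐ x ∂ν, ‖x‖ = 1)
    (hμ : ∀ U : E ≃ₗᵢ[ℝ] E, μ.map U = μ) (hν : ∀ U : E ≃ₗᵢ[ℝ] E, ν.map U = ν) : μ = ν := by
  apply Measure.ext_of_charFun
  ext t
  have key : ∀ (μ ν : Measure E) [IsProbabilityMeasure μ] [IsProbabilityMeasure ν]
    (hνs : ∀ᵐ x ∂ν, ‖x‖ = 1) (hμ : ∀ U : E ≃ₗᵢ[ℝ] E, μ.map U = μ),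
    charFun μ t = ∫ y, ∫ x, Complex.exp ((‖t‖ * inner ℝ x y : ℝ) * Complex.I) ∂μ ∂ν := by
    intro μ ν _ _ hνs hμ
    have : ∫ y, charFun μ t ∂ν = charFun μ t := by simp
    rw [← this]
    apply integral_congr_ae
    filter_upwards [hνs] with y hy
    rw [jl_charFun_norm μ hμ t (‖t‖ • y) (by simp [norm_smul, hy]), charFun_apply]
    simp_rw [real_inner_smul_right]
  rw [key μ ν hνs hμ, key ν μ hμs hν, integral_integral_swap]
  · simp_rw [real_inner_comm]
  · refine Integrable.of_bound (C := 1) (Measurable.aestronglyMeasurable ?_) ?_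
    · simp only [Function.uncurry_def]
      fun_prop
    · refine Filter.Eventually.of_forall fun p => ?_
      simp only [Function.uncurry_def]
      rw [Complex.norm_exp_ofReal_mul_I]

theorem jl_gauss1 (α : ℝ) (hα : 0 < α) :
    Integrable (fun x : ℝ => Real.exp (-(α - 1) / 2 * x ^ 2)) (gaussianReal 0 1) ∧
    ∫ x, Real.exp (-(α - 1) / 2 * x ^ 2) ∂(gaussianReal 0 1) = (√α)⁻¹ := by
  have e : ∀ x : ℝ, gaussianPDFReal 0 1 x * Real.exp (-(α - 1) / 2 * x ^ 2)
      = (√(2 * Real.pi))⁻¹ * Real.exp (-(α / 2) * x ^ 2) := by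
    intro x
    rw [gaussianPDFReal_def]
    simp only [NNReal.coe_one, mul_one, sub_zero]
    rw [mul_assoc, ← Real.exp_add]
    congr 2; ring
  constructor
  · rw [gaussianReal_of_var_ne_zero _ one_ne_zero, integrable_withDensity_iff_integrable_smul₀'
      (by fun_prop) (by simp [gaussianPDF])]
    simp only [gaussianPDF, smul_eq_mul]
    simp_rw [ENNReal.toReal_ofReal (gaussianPDFReal_nonneg _ _ _), e]
    exact (integrable_exp_neg_mul_sq (by positivity)).const_mul _
  · rw [integral_gaussianReal_eq_integral_smul one_ne_zero]
    simp_rw [smul_eq_mul, e]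
    rw [integral_const_mul, integral_gaussian]
    rw [show Real.pi / (α/2) = (2 * Real.pi) / α by field_simp, Real.sqrt_div (by positivity)]
    have : √(2 * Real.pi) ≠ 0 := by positivity
    field_simp

theorem jl_gauss {ι : Type*} [Fintype ι] (α : ι → ℝ) (hα : ∀ i, 0 < α i) :
    Measure.pi (fun _ : ι => gaussianReal 0 1) {g | ∑ i, (α i - 1) * g i ^ 2 ≤ 0}
      ≤ ENNReal.ofReal (∏ i, (√(α i))⁻¹) := by
  have h1 : ∀ g : ι → ℝ, ∏ i, Real.exp (-(α i - 1) / 2 * g i ^ 2)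
      = Real.exp (-(∑ i, (α i - 1) * g i ^ 2) / 2) := by
    intro g
    rw [← Real.exp_sum, neg_div, Finset.sum_div, ← Finset.sum_neg_distrib]
    congr 1
    apply Finset.sum_congr rfl; intros; ring
  have hint : Integrable (fun g : ι → ℝ => ∏ i, Real.exp (-(α i - 1) / 2 * g i ^ 2))
      (Measure.pi (fun _ : ι => gaussianReal 0 1)) :=
    Integrable.fintype_prod (f := fun i x => Real.exp (-(α i - 1) / 2 * x ^ 2))
      (fun i => (jl_gauss1 (α i) (hα i)).1)
  have hval : ∫ g, ∏ i, Real.exp (-(α i - 1) / 2 * g i ^ 2)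
      ∂(Measure.pi (fun _ : ι => gaussianReal 0 1)) = ∏ i, (√(α i))⁻¹ := by
    rw [integral_fintype_prod_eq_prod (fun i x => Real.exp (-(α i - 1) / 2 * x ^ 2))]
    exact Finset.prod_congr rfl (fun i _ => (jl_gauss1 (α i) (hα i)).2)
  rw [← hval, ofReal_integral_eq_lintegral_ofReal hint
    (Filter.Eventually.of_forall fun g => by positivity)]
  have := mul_meas_ge_le_lintegral₀ (μ := Measure.pi (fun _ : ι => gaussianReal 0 1))
    (hint.1.aemeasurable.ennreal_ofReal) 1
  rw [one_mul] at this
  refine le_trans (measure_mono ?_) this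
  intro g hg
  simp only [Set.mem_ofPred_eq] at hg ⊢
  rw [h1, ENNReal.one_le_ofReal, Real.one_le_exp_iff]
  linarith

theorem jl_sphere {n : ℕ} (hn : 1 ≤ n) (μ : Measure (EuclideanSpace ℝ (Fin n)))
    [IsProbabilityMeasure μ] (hsphere : ∀ᵐ x ∂μ, ‖x‖ = 1)
    (hinv : ∀ U : EuclideanSpace ℝ (Fin n) ≃ₗᵢ[ℝ] EuclideanSpace ℝ (Fin n), μ.map U = μ)
    (α : Fin n → ℝ) (hα : ∀ i, 0 < α i) :
    μ {x | ∑ i, (α i - 1) * x i ^ 2 ≤ 0} ≤ ENNReal.ofReal (∏ i, (√(α i))⁻¹) := by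
  have i0 : Fin n := ⟨0, hn⟩
  have := nullSingletonClass_gaussianReal (μ := 0) (one_ne_zero (α := NNReal))
  set γ := stdGaussian (EuclideanSpace ℝ (Fin n)) with hγ
  have hne : ∀ᵐ x ∂γ, x ≠ 0 := by
    rw [hγ, ← map_pi_eq_stdGaussian, ae_map_iff (p := fun x => x ≠ 0) (by fun_prop)
      (measurableSet_singleton _).compl]
    have : NullSingletonClass (Measure.pi (fun _ : Fin n => gaussianReal 0 1)) := Measure.pi_nullSingletonClass i0
    rw [ae_iff]
    simp
  let f : EuclideanSpace ℝ (Fin n) → EuclideanSpace ℝ (Fin n) := fun x => ‖x‖⁻¹ • x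
  have hf : Measurable f := by fun_prop
  have hp : IsProbabilityMeasure (γ.map f) := Measure.isProbabilityMeasure_map hf.aemeasurable
  have heq : μ = γ.map f := by
    apply jl_uniq _ _ hsphere _ hinv
    · intro U
      conv_rhs => rw [hγ, ← stdGaussian_map U]
      rw [Measure.map_map (by fun_prop) hf, Measure.map_map hf (by fun_prop)]
      congr 1
      ext1 x
      simp [f]
    · rw [ae_map_iff hf.aemeasurable (measurableSet_eq_fun (by fun_prop) (by fun_prop))]
      filter_upwards [hne] with x hx
      have : ‖x‖ ≠ 0 := by simpa using hx
      simp [f, norm_smul, this]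
  have hmeas : MeasurableSet {x : EuclideanSpace ℝ (Fin n) | ∑ i, (α i - 1) * x i ^ 2 ≤ 0} :=
    measurableSet_le (by fun_prop) (by fun_prop)
  rw [heq, Measure.map_apply hf hmeas]
  refine le_trans (measure_mono_ae (t := {x | ∑ i, (α i - 1) * x i ^ 2 ≤ 0}) ?_) ?_
  · filter_upwards [hne] with x hx h
    have hx : 0 < ‖x‖ := by simpa using hx
    have h : ∑ i, (α i - 1) * (‖x‖⁻¹ * x i) ^ 2 ≤ 0 := h
    have e : ∑ i, (α i - 1) * (‖x‖⁻¹ * x i) ^ 2 = (‖x‖⁻¹)^2 * ∑ i, (α i - 1) * (x i) ^ 2 := by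
      rw [Finset.mul_sum]; apply Finset.sum_congr rfl; intros; ring
    rw [e] at h
    change ∑ i, (α i - 1) * (x i) ^ 2 ≤ 0
    have : 0 < (‖x‖⁻¹)^2 := by positivity
    by_contra hc
    push Not at hc
    have := mul_pos this hc
    linarith
  · rw [hγ, ← map_pi_eq_stdGaussian, Measure.map_apply (by fun_prop) hmeas]
    exact jl_gauss α hα

theorem jl_two {n a : ℕ} (ha : 1 ≤ a) (han : a ≤ n) (μ : Measure (EuclideanSpace ℝ (Fin n)))
    [IsProbabilityMeasure μ] (hsphere : ∀ᵐ x ∂μ, ‖x‖ = 1)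
    (hinv : ∀ U : EuclideanSpace ℝ (Fin n) ≃ₗᵢ[ℝ] EuclideanSpace ℝ (Fin n), μ.map U = μ)
    (P Q B : ℝ) (hP : 0 < P) (hQ : 0 < Q) (S : Set (ℝ))
    (hS : ∀ L ∈ S, L ≤ 1 → (P - 1) * L + (Q - 1) * (1 - L) ≤ 0)
    (hB : -(a * Real.log P + (n - a) * Real.log Q) / 2 ≤ B) :
    μ {x | ∑ i ∈ Finset.univ.filter (fun i : Fin n => (i : ℕ) < a), (x i) ^ 2 ∈ S}
      ≤ ENNReal.ofReal (Real.exp B) := by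
  have h := jl_sphere (ha.trans han) μ hsphere hinv
    (fun i => if (i : ℕ) < a then P else Q) (fun i => by split_ifs <;> assumption)
  refine le_trans (measure_mono_ae ?_) (h.trans (ENNReal.ofReal_le_ofReal ?_))
  · filter_upwards [hsphere] with x hx hxS
    have hxS : ∑ i ∈ Finset.univ.filter (fun i : Fin n => (i : ℕ) < a), (x i) ^ 2 ∈ S := hxS
    change ∑ i : Fin n, ((if (i : ℕ) < a then P else Q) - 1) * x i ^ 2 ≤ 0
    have h1 : ∑ i, x i ^ 2 = 1 := by
      rw [← EuclideanSpace.real_norm_sq_eq, hx]; norm_num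
    rw [← Finset.sum_filter_add_sum_filter_not _ (fun i : Fin n => (i : ℕ) < a)] at h1 ⊢
    have hnn : 0 ≤ ∑ i ∈ Finset.univ.filter (fun i : Fin n => ¬ (i : ℕ) < a), (x i) ^ 2 :=
      Finset.sum_nonneg fun _ _ => by positivity
    have h2 := hS _ hxS (by linarith)
    refine le_trans (le_of_eq ?_) h2
    rw [← eq_sub_iff_add_eq'] at h1
    rw [← h1, Finset.mul_sum, Finset.mul_sum]
    congr 1
    · apply Finset.sum_congr rfl
      intro i hi
      rw [if_pos (Finset.mem_filter.1 hi).2]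
    · apply Finset.sum_congr rfl
      intro i hi
      rw [if_neg (Finset.mem_filter.1 hi).2]
  · have e : ∀ R : ℝ, 0 < R → (√R)⁻¹ = Real.exp (-Real.log R / 2) := by
      intro R hR
      rw [← Real.exp_log (inv_pos.2 (Real.sqrt_pos.2 hR)), Real.log_inv, Real.log_sqrt hR.le,
        neg_div]
    have c1 : (Finset.univ.filter (fun i : Fin n => (i : ℕ) < a)).card = a := by
      rw [Fin.card_filter_val_lt]; omega
    have c2 : (Finset.univ.filter (fun i : Fin n => ¬ (i : ℕ) < a)).card = n - a := by
      have := Finset.card_filter_add_card_filter_not (s := (Finset.univ : Finset (Fin n)))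
        (fun i : Fin n => (i : ℕ) < a)
      rw [c1, Finset.card_univ, Fintype.card_fin] at this
      omega
    have : ∀ i : Fin n, (√(if (i : ℕ) < a then P else Q))⁻¹
        = if (i : ℕ) < a then (√P)⁻¹ else (√Q)⁻¹ := fun i => by split_ifs <;> rfl
    simp_rw [this]
    rw [Finset.prod_ite, Finset.prod_const, Finset.prod_const, c1, c2, e P hP, e Q hQ,
      ← Real.exp_nat_mul, ← Real.exp_nat_mul, ← Real.exp_add, Real.exp_le_exp, Nat.cast_sub han]
    refine le_trans (le_of_eq ?_) hB
    ring

theorem jl_log1 (β : ℝ) (h0 : 0 ≤ β) (h1 : β < 1 / 2) : Real.log (1 - β) + β ≤ -(β ^ 2) / 2 := by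
  have h := Real.hasSum_pow_div_log_of_abs_lt_one (x := β) (by rw [abs_of_nonneg h0]; linarith)
  have h2 := sum_le_hasSum (Finset.range 2) (fun i _ => by positivity) h
  norm_num [Finset.sum_range_succ] at h2
  linarith

theorem jl_log2 (β : ℝ) (h0 : 0 ≤ β) (h1 : β < 1 / 2) : Real.log (1 + β) - β ≤ -(β ^ 2) / 4 := by
  have h := Real.quadratic_le_exp_of_nonneg (x := β - β ^ 2 / 4) (by nlinarith)
  have h2 : 1 / 2 ≤ (1 - β / 4) ^ 2 := by nlinarith
  have h3 : 1 + β ≤ Real.exp (β - β ^ 2 / 4) := by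
    have := mul_le_mul_of_nonneg_left h2 (sq_nonneg β)
    nlinarith
  have := (Real.log_le_iff_le_exp (by linarith)).2 h3
  linarith

theorem jl_main (n a : ℕ) (ha : 1 ≤ a) (han : a ≤ n)
    (μ : Measure (EuclideanSpace ℝ (Fin n))) [IsProbabilityMeasure μ]
    (hsphere : ∀ᵐ x ∂μ, ‖x‖ = 1)
    (hinv : ∀ U : EuclideanSpace ℝ (Fin n) ≃ₗᵢ[ℝ] EuclideanSpace ℝ (Fin n),
      μ.map U = μ)
    (β : ℝ) (hβ0 : 0 ≤ β) (hβ : β < 1 / 2) :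
    μ {x | ∑ i ∈ Finset.univ.filter (fun i : Fin n => (i : ℕ) < a), (x i) ^ 2
            ≤ (1 - β) * a / n }
        ≤ ENNReal.ofReal (Real.exp (-(a * β ^ 2) / 4)) ∧
    μ {x | (1 + β) * a / n
            ≤ ∑ i ∈ Finset.univ.filter (fun i : Fin n => (i : ℕ) < a), (x i) ^ 2 }
        ≤ ENNReal.ofReal (Real.exp (-(a * β ^ 2) / 8)) := by
  rcases hβ0.eq_or_lt with rfl | hβp
  · constructor <;> · refine prob_le_one.trans ?_; simp
  have hA : (1 : ℝ) ≤ a := by exact_mod_cast ha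
  have hN : (a : ℝ) ≤ n := by exact_mod_cast han
  rcases han.eq_or_lt with rfl | hlt
  · have key : ∀ᵐ x ∂μ, ∑ i ∈ Finset.univ.filter (fun i : Fin a => (i : ℕ) < a), (x i) ^ 2 = 1 := by
      filter_upwards [hsphere] with x hx
      simp only [Fin.is_lt, Finset.filter_true]
      rw [← EuclideanSpace.real_norm_sq_eq, hx]; norm_num
    have ha0 : (a : ℝ) ≠ 0 := by positivity
    simp_rw [mul_div_cancel_right₀ _ ha0]
    constructor <;>
    · refine le_trans (le_of_eq ?_) zero_le
      rw [measure_eq_zero_iff_ae_notMem]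
      filter_upwards [key] with x hx
      rw [hx]
      linarith
  have hd : (0 : ℝ) < n - a := by
    have : (a : ℝ) < n := by exact_mod_cast hlt
    linarith
  have hn0 : (0 : ℝ) < n := by linarith
  -- optimal bound
  have opt : ∀ b : ℝ, 0 < b → b * a < n →
      -(a * Real.log (1 / b) + (n - a) * Real.log ((n - a) / (n - b * a))) / 2
        ≤ a / 2 * (Real.log b + 1 - b) := by
    intro b hb hbn
    have hq : 0 < (n - b * a) / (n - a : ℝ) := div_pos (by linarith) hd
    have h1 := Real.log_le_sub_one_of_pos hq
    rw [one_div, Real.log_inv, ← inv_div (n - b * a : ℝ), Real.log_inv]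
    have h2 := mul_le_mul_of_nonneg_left h1 hd.le
    have h3 : (n - a : ℝ) * ((n - b * a) / (n - a : ℝ) - 1) = a - b * a := by
      field_simp; ring
    linarith
  have e1 : ∀ b L : ℝ, 0 < b → b * a < n →
      (1 / b - 1) * L + ((n - a) / (n - b * a) - 1) * (1 - L)
        = (1 - b) * (n * L - b * a) / (b * (n - b * a)) := by
    intro b L hb hbn
    have : (n - b * a : ℝ) ≠ 0 := by linarith
    field_simp
    ring
  constructor
  · have hb : 0 < 1 - β := by linarith
    have hbn : (1 - β) * a < n := by nlinarith
    refine jl_two ha han μ hsphere hinv (1 / (1 - β)) ((n - a) / (n - (1 - β) * a)) _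
      (by positivity) (div_pos hd (by linarith)) (Set.Iic ((1 - β) * a / n)) ?_
      ((opt _ hb hbn).trans ?_)
    · intro L hL _
      rw [e1 _ _ hb hbn]
      rw [Set.mem_Iic, le_div_iff₀ hn0] at hL
      apply div_nonpos_of_nonpos_of_nonneg
      · apply mul_nonpos_of_nonneg_of_nonpos <;> linarith
      · apply mul_nonneg <;> linarith
    · have := mul_le_mul_of_nonneg_left (jl_log1 β hβ0 hβ) (by positivity : (0 : ℝ) ≤ a / 2)
      linarith
  · have hb : 0 < 1 + β := by linarith
    rcases lt_or_ge ((1 + β) * a) n with hbn | hbn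
    · refine jl_two ha han μ hsphere hinv (1 / (1 + β)) ((n - a) / (n - (1 + β) * a)) _
        (by positivity) (div_pos hd (by linarith)) (Set.Ici ((1 + β) * a / n)) ?_
        ((opt _ hb hbn).trans ?_)
      · intro L hL _
        rw [e1 _ _ hb hbn]
        rw [Set.mem_Ici, div_le_iff₀ hn0] at hL
        apply div_nonpos_of_nonpos_of_nonneg
        · apply mul_nonpos_of_nonpos_of_nonneg <;> linarith
        · apply mul_nonneg <;> linarith
      · have := mul_le_mul_of_nonneg_left (jl_log2 β hβ0 hβ) (by positivity : (0 : ℝ) ≤ a / 2)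
        linarith
    · refine jl_two ha han μ hsphere hinv 1 (Real.exp a) _
        one_pos (Real.exp_pos _) (Set.Ici ((1 + β) * a / n)) ?_ ?_
      · intro L hL hL1
        have h1 : 1 ≤ (1 + β) * a / n := by rw [le_div_iff₀ hn0]; linarith
        have h2 : L = 1 := le_antisymm hL1 (h1.trans hL)
        simp [h2]
      · have : (1 : ℝ) ≤ n - a := by
          have : (a : ℝ) + 1 ≤ n := by exact_mod_cast hlt
          linarith
        rw [Real.log_one, Real.log_exp]
        have h3 : β ^ 2 ≤ 1 := by nlinarith
        nlinarith

/-- Johnson–Lindenstrauss concentration (the paper's Fact 3): for `x` drawn from the uniform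
probability measure on the unit sphere of `ℝⁿ` (characterized as the rotation-invariant Borel
probability measure supported on the sphere), the squared length `L(x)` of the projection of
`x` onto the first `a` coordinates satisfies, for all `0 ≤ β < 1/2`,
`Pr[L ≤ (1−β)a/n] ≤ exp(−aβ²/4)` and `Pr[L ≥ (1+β)a/n] ≤ exp(−aβ²/8)`. -/
theorem jl_concentration (n a : ℕ) (ha : 1 ≤ a) (han : a ≤ n)
    [MeasurableSpace (EuclideanSpace ℝ (Fin n))] [BorelSpace (EuclideanSpace ℝ (Fin n))]
    (μ : Measure (EuclideanSpace ℝ (Fin n))) [IsProbabilityMeasure μ]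
    (hsphere : ∀ᵐ x ∂μ, ‖x‖ = 1)
    (hinv : ∀ U : EuclideanSpace ℝ (Fin n) ≃ₗᵢ[ℝ] EuclideanSpace ℝ (Fin n),
      μ.map U = μ)
    (β : ℝ) (hβ0 : 0 ≤ β) (hβ : β < 1 / 2) :
    μ {x | ∑ i ∈ Finset.univ.filter (fun i : Fin n => (i : ℕ) < a), (x i) ^ 2
            ≤ (1 - β) * a / n }
        ≤ ENNReal.ofReal (Real.exp (-(a * β ^ 2) / 4)) ∧
    μ {x | (1 + β) * a / n
            ≤ ∑ i ∈ Finset.univ.filter (fun i : Fin n => (i : ℕ) < a), (x i) ^ 2 }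
        ≤ ENNReal.ofReal (Real.exp (-(a * β ^ 2) / 8)) := by
  obtain rfl : ‹MeasurableSpace (EuclideanSpace ℝ (Fin n))› = WithLp.measurableSpace 2 _ := by
    rw [BorelSpace.measurable_eq (α := EuclideanSpace ℝ (Fin n))]
    exact (@BorelSpace.measurable_eq (EuclideanSpace ℝ (Fin n)) _ (WithLp.measurableSpace 2 _)
      inferInstance).symm
  exact jl_main n a ha han μ hsphere hinv β hβ0 hβ
end

section
/- Let m ≥ 1 and let r, s, t : Fin m → Bool satisfy 3 · hammingDist r s ≥ m. Then (1 − hammingDist r t / m) · (1 − hammingDist s t / m) ≤ 25/36 (as real numbers). (This is the soundness core of the paper's RRR protocol for non-Equality: if on input x = y the true row is t and Merlin sends rows r, s that differ in at least m/3 positions, and the referee tests r against a uniformly random coordinate of Alice's column and s against an independent uniformly random coordinate of Bob's column, then the probability that both tests pass is at most 25/36, bounded away from 1.) -/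
/-- Soundness core of the RRR protocol for non-Equality: if `r` and `s` differ in at least
`m/3` positions, and each is tested against the true row `t` at an independent uniformly
random coordinate, then the probability that both tests pass, namely
`(1 − d(r,t)/m)·(1 − d(s,t)/m)`, is at most `25/36`. -/
theorem ne_soundness (m : ℕ) (hm : 1 ≤ m) (r s t : Fin m → Bool)
    (hrs : 3 * hammingDist r s ≥ m) :
    (1 - (hammingDist r t : ℝ) / m) * (1 - (hammingDist s t : ℝ) / m) ≤ 25 / 36 := by
  have h1 : hammingDist r s ≤ hammingDist r t + hammingDist s t := by
    rw [hammingDist_comm s t]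
    exact hammingDist_triangle r t s
  have h2 : hammingDist r t ≤ m := by
    simpa using (hammingDist_le_card_fintype (x := r) (y := t))
  have h3 : hammingDist s t ≤ m := by
    simpa using (hammingDist_le_card_fintype (x := s) (y := t))
  have h4 : m ≤ 3 * (hammingDist r t + hammingDist s t) := by omega
  have hm0 : (0 : ℝ) < m := by exact_mod_cast hm
  have ha : (hammingDist r t : ℝ) / m ≤ 1 := by
    rw [div_le_one hm0]; exact_mod_cast h2
  have hb : (hammingDist s t : ℝ) / m ≤ 1 := by
    rw [div_le_one hm0]; exact_mod_cast h3
  have hab : 1 / 3 ≤ (hammingDist r t : ℝ) / m + (hammingDist s t : ℝ) / m := by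
    rw [← add_div, le_div_iff₀ hm0]
    have : (m : ℝ) ≤ 3 * ((hammingDist r t : ℝ) + hammingDist s t) := by exact_mod_cast h4
    linarith
  generalize (hammingDist r t : ℝ) / m = a at *
  generalize (hammingDist s t : ℝ) / m = b at *
  have h5 : (2 - a - b) ^ 2 ≤ (5 / 3) ^ 2 :=
    pow_le_pow_left₀ (by linarith) (by linarith) 2
  nlinarith [sq_nonneg (a - b)]
end
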